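/- Let n be odd and let f be a monotone Boolean function of n variables such that every minimal one of f lies in one of the layers E^{n,(n-1)/2}, E^{n,(n+1)/2}, E^{n,(n+3)/2}, and f(x) = 1 for every x with at least (n+5)/2 ones. Then for every j \in \{1,...,n\}: 2^{n-1} \alpha_j^f = A + B + C + D, where A = #\{x \in E^{n,(n-1)/2} : f(x) = 1, x_j = 1\}, B = #\{x \in E^{n,(n-1)/2} : f(x) = 0, x_j = 0, f(x \oplus e_j) = 1\}, C = #\{x \in E^{n,(n+3)/2} : f(x) = 0, x_j = 0\}, and D = #\{x \in E^{n,(n+3)/2} : f(x) = 1, x_j = 1, f(x \oplus e_j) = 0\}. -/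

import Mathlib

open Finset

/-- `x` with its `j`-th coordinate set to `b`. -/
def setCoord {n : ℕ} (x : Fin n → Bool) (j : Fin n) (b : Bool) : Fin n → Bool :=
  Function.update x j b

/-- `x` with its `j`-th coordinate flipped (`x ⊕ e_j`). -/
def flipCoord {n : ℕ} (x : Fin n → Bool) (j : Fin n) : Fin n → Bool :=
  Function.update x j (!x j)

/-- Number of ones of a Boolean vector. -/
def weight {n : ℕ} (x : Fin n → Bool) : ℕ :=
  (Finset.univ.filter fun i => x i = true).card

/-- The activity `α_j^f = 2^{-n} ∑_x (f(x^{(j,0)}) ⊕ f(x^{(j,1)}))`. -/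
noncomputable def activity {n : ℕ} (f : (Fin n → Bool) → Bool) (j : Fin n) : ℝ :=
  (2 ^ n : ℝ)⁻¹ * ∑ x : Fin n → Bool,
    (if f (setCoord x j false) ≠ f (setCoord x j true) then (1 : ℝ) else 0)

/-- The sensitivity `s^f(x)` of `f` at `x`. -/
def sensAt {n : ℕ} (f : (Fin n → Bool) → Bool) (x : Fin n → Bool) : ℕ :=
  (Finset.univ.filter fun i => f (flipCoord x i) ≠ f x).card

/-- The average sensitivity `s^f`. -/
noncomputable def avgSens {n : ℕ} (f : (Fin n → Bool) → Bool) : ℝ :=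
  (2 ^ n : ℝ)⁻¹ * ∑ x : Fin n → Bool, (sensAt f x : ℝ)

/-- `x` is a minimal one of the (monotone) function `f`. -/
def MinimalOne {n : ℕ} (f : (Fin n → Bool) → Bool) (x : Fin n → Bool) : Prop :=
  f x = true ∧ ∀ y, y < x → f y = false

/-- `x` is a maximal zero of the (monotone) function `f`. -/
def MaximalZero {n : ℕ} (f : (Fin n → Bool) → Bool) (x : Fin n → Bool) : Prop :=
  f x = false ∧ ∀ y, x < y → f y = true

theorem flipCoord_flipCoord {n : ℕ} (x : Fin n → Bool) (j : Fin n) :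
    flipCoord (flipCoord x j) j = x := by
  simp [flipCoord]

theorem flipCoord_apply_self {n : ℕ} (x : Fin n → Bool) (j : Fin n) :
    flipCoord x j j = !x j := by
  simp [flipCoord]

theorem weight_flipCoord_of_eq_false {n : ℕ} {x : Fin n → Bool} {j : Fin n}
    (h : x j = false) : weight (flipCoord x j) = weight x + 1 := by
  have hset : (univ.filter fun i => flipCoord x j i = true) =
      insert j (univ.filter fun i => x i = true) := by
    ext i
    by_cases hi : i = j
    · subst hi
      simp [flipCoord, h]
    · simp only [mem_filter, mem_insert, mem_univ, true_and, hi, false_or]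
      rw [flipCoord, Function.update_of_ne hi]
  rw [weight, hset, card_insert_of_notMem (by simp [h]), weight]

theorem weight_mono {n : ℕ} {x y : Fin n → Bool} (h : x ≤ y) : weight x ≤ weight y :=
  card_le_card <| monotone_filter_right _ fun i _ hi => h i hi

theorem exists_minimalOne_le {n : ℕ} {f : (Fin n → Bool) → Bool} {x : Fin n → Bool}
    (h : f x = true) : ∃ y ≤ x, MinimalOne f y := by
  obtain ⟨y, hyx, hy⟩ := exists_minimal_le_of_wellFoundedLT (fun z => f z = true) x h
  refine ⟨y, hyx, hy.prop, fun z hz => ?_⟩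
  simpa using hy.not_prop_of_lt hz

/-- The lower endpoints of the edges in direction `j` along which `f` rises from `0` to `1`. -/
def risingEdges {n : ℕ} (f : (Fin n → Bool) → Bool) (j : Fin n) : Finset (Fin n → Bool) :=
  univ.filter fun x => x j = false ∧ f x = false ∧ f (flipCoord x j) = true

/-- The upper endpoints of rising edges in layer `k` are equinumerous with the corresponding
lower endpoints. -/
theorem card_upper_risingEdges {n : ℕ} (f : (Fin n → Bool) → Bool) (j : Fin n) (k : ℕ) :
    #{x : Fin n → Bool | weight x = k ∧ f x = true ∧ x j = true ∧
      f (flipCoord x j) = false} = #{x ∈ risingEdges f j | weight x + 1 = k} := by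
  refine card_nbij' (flipCoord · j) (flipCoord · j) ?_ ?_
    (fun x _ => flipCoord_flipCoord x j) (fun x _ => flipCoord_flipCoord x j)
  · intro x hx
    simp only [coe_filter, mem_univ, true_and, Set.mem_ofPred_eq, risingEdges, mem_filter] at hx ⊢
    have hj : flipCoord x j j = false := by simp [flipCoord_apply_self, hx.2.2.1]
    have hw := weight_flipCoord_of_eq_false hj
    rw [flipCoord_flipCoord] at hw ⊢
    exact ⟨⟨hj, hx.2.2.2, hx.2.1⟩, hw.symm.trans hx.1⟩
  · intro x hx
    simp only [coe_filter, mem_univ, true_and, Set.mem_ofPred_eq, risingEdges, mem_filter] at hx ⊢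
    rw [flipCoord_flipCoord, weight_flipCoord_of_eq_false hx.1.1, flipCoord_apply_self]
    exact ⟨hx.2, hx.1.2.2, by simp [hx.1.1], hx.1.2.1⟩

theorem card_sensitive_eq_two_mul_card_risingEdges {n : ℕ} {f : (Fin n → Bool) → Bool}
    (hf : Monotone f) (j : Fin n) :
    #{x : Fin n → Bool | f (setCoord x j false) ≠ f (setCoord x j true)} =
      2 * #(risingEdges f j) := by
  have hmono (x : Fin n → Bool) : f (setCoord x j false) ≠ f (setCoord x j true) ↔
      f (setCoord x j false) = false ∧ f (setCoord x j true) = true := by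
    have hle : setCoord x j false ≤ setCoord x j true :=
      update_le_update_iff.2 ⟨Bool.false_le _, fun _ _ => le_rfl⟩
    have := hf hle
    revert this
    cases f (setCoord x j false) <;> cases f (setCoord x j true) <;> simp
  have hself (x : Fin n → Bool) (b : Bool) (h : x j = b) : setCoord x j b = x := by
    subst h
    simp [setCoord]
  have hflip (x : Fin n → Bool) (b : Bool) (h : x j = !b) : setCoord x j b = flipCoord x j := by
    simp [setCoord, flipCoord, h]
  have hlow : ({x ∈ {x : Fin n → Bool | f (setCoord x j false) ≠ f (setCoord x j true)} |
      x j = false} : Finset _) = risingEdges f j := by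
    ext x
    simp only [mem_filter, mem_univ, true_and, risingEdges, hmono]
    cases h : x j
    · simp [hself x false h, hflip x true h]
    · simp
  have hup : #{x ∈ {x : Fin n → Bool | f (setCoord x j false) ≠ f (setCoord x j true)} |
      ¬ x j = false} = #(risingEdges f j) := by
    refine card_nbij' (flipCoord · j) (flipCoord · j) ?_ ?_
      (fun x _ => flipCoord_flipCoord x j) (fun x _ => flipCoord_flipCoord x j)
    · intro x hx
      simp only [coe_filter, mem_filter, mem_univ, true_and, Set.mem_ofPred_eq, hmono,
        Bool.not_eq_false, risingEdges] at hx ⊢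
      rw [hself x true hx.2, hflip x false hx.2] at hx
      rw [flipCoord_flipCoord, flipCoord_apply_self]
      simp [hx]
    · intro x hx
      simp only [coe_filter, mem_filter, mem_univ, true_and, Set.mem_ofPred_eq, hmono,
        Bool.not_eq_false, risingEdges] at hx ⊢
      have hj : flipCoord x j j = true := by simp [flipCoord_apply_self, hx.1]
      rw [hself _ true hj, hflip _ false hj, flipCoord_flipCoord]
      exact ⟨hx.2, hj⟩
  rw [← card_filter_add_card_filter_not (fun x : Fin n → Bool => x j = false), hlow, hup, two_mul]

theorem two_pow_mul_activity {n : ℕ} {f : (Fin n → Bool) → Bool} (hf : Monotone f)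
    (j : Fin n) : (2 : ℝ) ^ (n - 1) * activity f j = #(risingEdges f j) := by
  obtain ⟨m, rfl⟩ : ∃ m, n = m + 1 := ⟨n - 1, by have := j.pos; omega⟩
  rw [activity, sum_boole, card_sensitive_eq_two_mul_card_risingEdges hf]
  push_cast
  rw [pow_succ]
  field_simp

/-- odd `n`, second class: decomposition of `2^{n-1} α_j^f` into the four
relevant counts for a monotone function whose minimal ones lie in the layers
`(n-1)/2, (n+1)/2, (n+3)/2` and which equals `1` from layer `(n+5)/2` upward. -/
theorem activity_decomposition_odd_second (n : ℕ) (hn : Odd n) (f : (Fin n → Bool) → Bool)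
    (hf : Monotone f)
    (hmin : ∀ x, MinimalOne f x →
      weight x = (n - 1) / 2 ∨ weight x = (n + 1) / 2 ∨ weight x = (n + 3) / 2)
    (hone : ∀ x, (n + 5) / 2 ≤ weight x → f x = true) (j : Fin n) :
    (2 : ℝ) ^ (n - 1) * activity f j =
      ({x : Fin n → Bool | weight x = (n - 1) / 2 ∧ f x = true ∧ x j = true}.ncard : ℝ) +
      ({x : Fin n → Bool | weight x = (n - 1) / 2 ∧ f x = false ∧ x j = false ∧
          f (flipCoord x j) = true}.ncard : ℝ) +
      ({x : Fin n → Bool | weight x = (n + 3) / 2 ∧ f x = false ∧ x j = false}.ncard : ℝ) +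
      ({x : Fin n → Bool | weight x = (n + 3) / 2 ∧ f x = true ∧ x j = true ∧
          f (flipCoord x j) = false}.ncard : ℝ) := by
  have hzero (x : Fin n → Bool) (hx : weight x < (n - 1) / 2) : f x = false := by
    by_contra h
    obtain ⟨y, hyx, hy⟩ := exists_minimalOne_le (by simpa using h)
    have := weight_mono hyx
    have := hmin y hy
    omega
  obtain ⟨m, rfl⟩ := hn
  have hm₀ : (2 * m + 1 - 1) / 2 = m := by omega
  have hm₂ : (2 * m + 1 + 3) / 2 = m + 2 := by omega
  have hm₃ : (2 * m + 1 + 5) / 2 = m + 3 := by omega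
  rw [hm₀] at hzero
  rw [hm₃] at hone
  rw [hm₀, hm₂, two_pow_mul_activity hf]
  have hA : {x : Fin (2 * m + 1) → Bool | weight x = m ∧ f x = true ∧ x j = true}.ncard =
      #{x ∈ risingEdges f j | weight x + 1 = m} := by
    rw [← card_upper_risingEdges, ← Set.ncard_coe_finset]
    congr 1
    ext x
    simp only [Set.mem_ofPred_eq, coe_filter, mem_univ, true_and]
    refine ⟨fun ⟨hw, hfx, hj⟩ => ⟨hw, hfx, hj, hzero _ ?_⟩, fun h => ⟨h.1, h.2.1, h.2.2.1⟩⟩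
    have := weight_flipCoord_of_eq_false (x := flipCoord x j) (j := j)
      (by simp [flipCoord_apply_self, hj])
    rw [flipCoord_flipCoord] at this
    omega
  have hB : {x : Fin (2 * m + 1) → Bool | weight x = m ∧ f x = false ∧ x j = false ∧
      f (flipCoord x j) = true}.ncard = #{x ∈ risingEdges f j | weight x = m} := by
    rw [← Set.ncard_coe_finset]
    congr 1
    ext x
    simp only [Set.mem_ofPred_eq, coe_filter, mem_univ, true_and, risingEdges, mem_filter]
    tauto
  have hC : {x : Fin (2 * m + 1) → Bool | weight x = m + 2 ∧ f x = false ∧ x j = false}.ncard =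
      #{x ∈ risingEdges f j | weight x = m + 2} := by
    rw [← Set.ncard_coe_finset]
    congr 1
    ext x
    simp only [Set.mem_ofPred_eq, coe_filter, mem_univ, true_and, risingEdges, mem_filter]
    refine ⟨fun ⟨hw, hfx, hj⟩ => ⟨⟨hj, hfx, hone _ ?_⟩, hw⟩, fun h => ⟨h.2, h.1.2.1, h.1.1⟩⟩
    rw [weight_flipCoord_of_eq_false hj, hw]
  have hD : {x : Fin (2 * m + 1) → Bool | weight x = m + 2 ∧ f x = true ∧ x j = true ∧
      f (flipCoord x j) = false}.ncard = #{x ∈ risingEdges f j | weight x + 1 = m + 2} := by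
    rw [← card_upper_risingEdges, ← Set.ncard_coe_finset]
    simp
  rw [hA, hB, hC, hD]
  norm_cast
  simp only [card_filter, ← sum_add_distrib]
  rw [card_eq_sum_ones]
  refine sum_congr rfl fun x hx => ?_
  simp only [risingEdges, mem_filter, mem_univ, true_and] at hx
  obtain ⟨hj, hfx, hfy⟩ := hx
  have hlow : m ≤ weight x + 1 := by
    by_contra h
    have := hzero (flipCoord x j) (by rw [weight_flipCoord_of_eq_false hj]; omega)
    simp [this] at hfy
  have hhigh : weight x < m + 3 := by
    by_contra h
    simp [hone x (by omega)] at hfx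
  split_ifs <;> omega
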